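/- Payment bound for the designed mechanism: For every ε > 0 there exists a constant C > 0 such that for all N ≥ 2, the expected payment to each individual i at the Nash equilibrium σ^(ε) (all individuals using the ε-strategy) of the mechanism R^{(N,ε)} satisfies E_{σ^(ε)}[R_i^{(N,ε)}(X)] ≤ V_LB(ε) + C·e^{−N·d}, where V_LB(ε) = g'(ε)·((e^ε+1)/e^ε)·((θ/(2θ−1))·(e^ε+1) − 1) and d = (1/2)·ln((e^ε+1)²/(4(θe^ε+1−θ)((1−θ)e^ε+θ))). -/

import Mathlib

open Real

/-- The set of possible reports: `some b` is report `b ∈ {0,1}`, `none` is nonparticipation `⊥`. -/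
abbrev Report := Option Bool

/-- A (behavioral) strategy: a conditional distribution of the report given the signal. -/
def IsStrategy (σ : Bool → Report → ℝ) : Prop :=
  (∀ s x, 0 ≤ σ s x) ∧ ∀ s, ∑ x : Report, σ s x = 1

/-- `P_σ(X ∈ E | S = s)`. -/
def probE (σ : Bool → Report → ℝ) (E : Finset Report) (s : Bool) : ℝ :=
  ∑ x ∈ E, σ s x

/-- One log-likelihood-ratio term `ln(a/b)`, with the convention `0/0 = 1`,
clamped into `[0,∞]` (this does not change the supremum defining the privacy level,
since the supremum is always ≥ 0). -/
noncomputable def llr (a b : ℝ) : ENNReal :=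
  if a = 0 ∧ b = 0 then 0
  else if b = 0 then ⊤
  else ENNReal.ofReal (Real.log (a / b))

/-- The (local) differential privacy level `ζ(σ)` of a strategy, valued in `[0,∞]`. -/
noncomputable def privLevel (σ : Bool → Report → ℝ) : ENNReal :=
  ⨆ (E : Finset Report), ⨆ (s : Bool), llr (probE σ E s) (probE σ E (!s))

/-- The privacy cost `g(ζ(σ))`, valued in extended reals (at `ζ = ∞` we take the
supremum extension of `g`). -/
noncomputable def privCost (g : ℝ → ℝ) (σ : Bool → Report → ℝ) : EReal :=
  if privLevel σ = ⊤ then ⨆ x ∈ Set.Ici (0:ℝ), ((g x : ℝ) : EReal)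
  else ((g (privLevel σ).toReal : ℝ) : EReal)

/-- `P(S_i = s | W = w) = θ` if `s = w`, else `1 - θ`. -/
def signalProb (θ : ℝ) (w s : Bool) : ℝ := if s = w then θ else 1 - θ

/-- Joint probability of state `w`, signals `s` and reports `x`, where `p = P_W(1)`. -/
def jointProb {N : ℕ} (p θ : ℝ) (σ : Fin N → Bool → Report → ℝ)
    (w : Bool) (s : Fin N → Bool) (x : Fin N → Report) : ℝ :=
  (if w then p else 1 - p) * ∏ i, (signalProb θ w (s i) * σ i (s i) (x i))

/-- Expected payment `E_σ[R_i(X)]` to individual `i`. -/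
noncomputable def expPay {N : ℕ} (p θ : ℝ) (σ : Fin N → Bool → Report → ℝ)
    (R : (Fin N → Report) → Fin N → ℝ) (i : Fin N) : ℝ :=
  ∑ w : Bool, ∑ s : Fin N → Bool, ∑ x : Fin N → Report,
    jointProb p θ σ w s x * R x i

/-- Expected utility of individual `i`: expected payment minus privacy cost. -/
noncomputable def utility {N : ℕ} (p θ : ℝ) (g : ℝ → ℝ)
    (σ : Fin N → Bool → Report → ℝ)
    (R : (Fin N → Report) → Fin N → ℝ) (i : Fin N) : EReal :=
  ((expPay p θ σ R i : ℝ) : EReal) - privCost g (σ i)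

/-- `σ` is a Nash equilibrium of the payment mechanism `R`. -/
def NashEq {N : ℕ} (p θ : ℝ) (g : ℝ → ℝ)
    (σ : Fin N → Bool → Report → ℝ)
    (R : (Fin N → Report) → Fin N → ℝ) : Prop :=
  (∀ i, IsStrategy (σ i)) ∧
  ∀ (i : Fin N) (σ' : Bool → Report → ℝ), IsStrategy σ' →
    utility p θ g (Function.update σ i σ') R i ≤ utility p θ g σ R i

/-- The `ε`-strategy: symmetric randomized response flipping with prob. `1/(e^ε+1)`. -/
noncomputable def epsStrategy (ε : ℝ) : Bool → Report → ℝ :=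
  fun s x => match x with
  | none => 0
  | some b => if b = s then Real.exp ε / (Real.exp ε + 1) else 1 / (Real.exp ε + 1)

/-- The lower bound `V_LB(ε)` on the value of `ε` units of privacy. -/
noncomputable def VLB (θ : ℝ) (g' : ℝ → ℝ) (ε : ℝ) : ℝ :=
  g' ε * ((Real.exp ε + 1) / Real.exp ε) *
    ((θ / (2 * θ - 1)) * (Real.exp ε + 1) - 1)

/-- The hypotheses on the privacy cost function `g` (with derivative `g'`):
proper (nonnegative, `g(0) = 0`, non-decreasing), convex, continuously differentiable,
and vanishing only at `0`. -/
structure ProperCost (g g' : ℝ → ℝ) : Prop where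
  conv : ConvexOn ℝ (Set.Ici 0) g
  deriv : ∀ x ∈ Set.Ici (0:ℝ), HasDerivAt g (g' x) x
  derivCont : ContinuousOn g' (Set.Ici 0)
  mono : MonotoneOn g (Set.Ici 0)
  nonneg : ∀ x ∈ Set.Ici (0:ℝ), 0 ≤ g x
  zero : g 0 = 0
  pos : ∀ x > (0:ℝ), 0 < g x


/-- The set of participants: individuals whose report is not `⊥`. -/
def participants {N : ℕ} (x : Fin N → Report) : Finset (Fin N) :=
  Finset.univ.filter (fun j => x j ≠ none)

/-- The majority `M_{−i}` of the other participants' reports: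
`1` iff the number of `1`-reports among participants other than `i` is at least
`⌊(n−1)/2⌋ + 1`, where `n` is the total number of participants. -/
def majOthers {N : ℕ} (x : Fin N → Report) (i : Fin N) : Bool :=
  ((participants x).card - 1) / 2 + 1 ≤
    (((participants x).erase i).filter (fun j => x j = some true)).card

/-- `α = θ·e^ε/(e^ε+1) + (1−θ)·1/(e^ε+1)`. -/
noncomputable def alphaP (θ ε : ℝ) : ℝ := (θ * Real.exp ε + 1 - θ) / (Real.exp ε + 1)

/-- `β^{(n)} = P(Binomial(n−1, α) ≥ ⌊(n−1)/2⌋ + 1)`. -/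
noncomputable def betaP (α : ℝ) (n : ℕ) : ℝ :=
  ∑ k ∈ Finset.Icc ((n-1)/2 + 1) (n-1),
    ((n-1).choose k : ℝ) * α^k * (1-α)^(n-1-k)

/-- `γ^{(n)}`: `1 − C(n−1,(n−1)/2)·α^{(n−1)/2}(1−α)^{(n−1)/2}` if `n−1` is even, else `1`. -/
noncomputable def gammaP (α : ℝ) (n : ℕ) : ℝ :=
  if (n-1) % 2 = 0 then
    1 - ((n-1).choose ((n-1)/2) : ℝ) * α^((n-1)/2) * (1-α)^((n-1)/2)
  else 1

/-- The payment parameter `A_{1,1}` (with `p = P_W(1)`). -/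
noncomputable def A11 (p θ α : ℝ) (n : ℕ) : ℝ :=
  (p * (1 - betaP α n) + (1-p) * (1 - (gammaP α n - betaP α n))) /
    ((2 * betaP α n - gammaP α n) * (2*θ - 1) * p * (1-p))

/-- The payment parameter `A_{0,0}` (with `p = P_W(1)`). -/
noncomputable def A00 (p θ α : ℝ) (n : ℕ) : ℝ :=
  (p * betaP α n + (1-p) * (gammaP α n - betaP α n)) /
    ((2 * betaP α n - gammaP α n) * (2*θ - 1) * p * (1-p))

/-- The designed payment mechanism `R^{(N,ε)}`: non-participants get `0`; if there is at
most one participant, everyone gets `0`; otherwise participant `i` receives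
`(g'(ε)(e^ε+1)²/(2e^ε))·A_{x_i, M_{−i}}`, where `A_{0,1} = A_{1,0} = 0`. -/
noncomputable def mechR (p θ : ℝ) (g' : ℝ → ℝ) (ε : ℝ) {N : ℕ}
    (x : Fin N → Report) (i : Fin N) : ℝ :=
  if (participants x).card ≤ 1 then 0
  else
    (g' ε * (Real.exp ε + 1)^2 / (2 * Real.exp ε)) *
      (match x i, majOthers x i with
        | some true, true => A11 p θ (alphaP θ ε) (participants x).card
        | some false, false => A00 p θ (alphaP θ ε) (participants x).card
        | _, _ => 0)

/-- The exponent `d = (1/2)·ln((e^ε+1)²/(4(θe^ε+1−θ)((1−θ)e^ε+θ)))`. -/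
noncomputable def dExp (θ ε : ℝ) : ℝ :=
  (1/2) * Real.log ((Real.exp ε + 1)^2 /
    (4 * (θ * Real.exp ε + 1 - θ) * ((1 - θ) * Real.exp ε + θ)))

/-- The law of a single report given the state, when the report agrees with the state with
probability `α`. -/
def reportProb (α : ℝ) (w : Bool) : Report → ℝ
  | none => 0
  | some b => if b = w then α else 1 - α

/-- The probability that a `Binomial(m, x)` variable, `x + y = 1`, exceeds `m / 2`. -/
def upperTail (m : ℕ) (x y : ℝ) : ℝ :=
  ∑ k ∈ Finset.Icc (m / 2 + 1) m, (m.choose k : ℝ) * x ^ k * y ^ (m - k)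

lemma betaP_succ (α : ℝ) (m : ℕ) : betaP α (m + 1) = upperTail m α (1 - α) := rfl

lemma sum_signalProb_mul_epsStrategy (θ ε : ℝ) (w : Bool) (x : Report) :
    ∑ s, signalProb θ w s * epsStrategy ε s x = reportProb (alphaP θ ε) w x := by
  have : Real.exp ε + 1 ≠ 0 := by positivity
  rcases x with _ | b
  · simp [epsStrategy, reportProb]
  · cases w <;> cases b <;>
      simp [epsStrategy, reportProb, signalProb, alphaP] <;> field_simp <;> ring

lemma expPay_epsStrategy (p θ ε : ℝ) {N : ℕ} (R : (Fin N → Report) → Fin N → ℝ) (i : Fin N) :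
    expPay p θ (fun _ => epsStrategy ε) R i =
      ∑ w : Bool, (if w then p else 1 - p) *
        ∑ x : Fin N → Bool, (∏ j, reportProb (alphaP θ ε) w (some (x j))) *
          R (fun j => some (x j)) i := by
  unfold expPay
  refine Finset.sum_congr rfl fun w _ => ?_
  rw [Finset.sum_comm]
  have key (x : Fin N → Report) :
      ∑ s : Fin N → Bool, jointProb p θ (fun _ => epsStrategy ε) w s x * R x i =
        (if w then p else 1 - p) * ((∏ j, reportProb (alphaP θ ε) w (x j)) * R x i) := by
    simp only [jointProb, ← Finset.sum_mul, ← Finset.mul_sum, mul_assoc]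
    congr 2
    simp only [← sum_signalProb_mul_epsStrategy]
    rw [Finset.prod_univ_sum, Fintype.piFinset_univ]
  simp only [key, ← Finset.mul_sum]
  congr 1
  refine (Fintype.sum_of_injective (fun (x : Fin N → Bool) j => some (x j)) ?_ _ _ ?_
    fun _ => rfl).symm
  · intro x y h
    funext j
    simpa using congrFun h j
  · intro x hx
    obtain ⟨j, hj⟩ : ∃ j, x j = none := by
      by_contra! h
      choose y hy using fun j => Option.ne_none_iff_exists'.mp (h j)
      exact hx ⟨y, funext fun j => (hy j).symm⟩
    rw [Finset.prod_eq_zero (Finset.mem_univ j) (by simp [hj, reportProb]), zero_mul]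

lemma participants_some {N : ℕ} (x : Fin N → Bool) :
    participants (fun j => some (x j)) = Finset.univ := by
  simp [participants]

lemma majOthers_insertNth {m : ℕ} (i : Fin (m + 1)) (b : Bool) (y : Fin m → Bool) :
    majOthers (fun j => some (i.insertNth (α := fun _ => Bool) b y j)) i =
      decide (m / 2 + 1 ≤ (Finset.univ.filter fun j => y j = true).card) := by
  have h : ((Finset.univ.erase i).filter fun j =>
      i.insertNth (α := fun _ => Bool) b y j = true).card =
        (Finset.univ.filter fun j => y j = true).card := by
    rw [← Finset.card_map (Fin.succAboveEmb i)]
    congr 1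
    ext j
    refine Fin.succAboveCases i ?_ (fun k => ?_) j <;> simp
  simp [majOthers, participants_some, h]

lemma sum_pi_bool_mul_card {m : ℕ} (f : Bool → ℝ) (G : ℕ → ℝ) :
    ∑ y : Fin m → Bool, (∏ j, f (y j)) * G (Finset.univ.filter fun j => y j = true).card =
      ∑ k ∈ Finset.range (m + 1),
        (m.choose k : ℝ) * f true ^ k * f false ^ (m - k) * G k := by
  have := Finset.sum_powerset_apply_card
    (fun k => f true ^ k * f false ^ (m - k) * G k) (x := (Finset.univ : Finset (Fin m)))
  simp only [Finset.card_univ, Fintype.card_fin, nsmul_eq_mul, Finset.powerset_univ] at this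
  simp only [mul_assoc] at this ⊢
  rw [← this]
  refine Finset.sum_bij' (fun y _ => Finset.univ.filter fun j => y j = true)
    (fun t _ j => decide (j ∈ t)) (by simp) (by simp) (by simp) (by simp) fun y _ => ?_
  rw [← mul_assoc]
  congr 1
  have hf (j : Fin m) : f (y j) = if y j = true then f true else f false := by
    cases y j <;> simp
  simp only [hf, Finset.prod_ite, Finset.prod_const]
  rw [Finset.filter_not, Finset.card_univ_sdiff, Fintype.card_fin]

lemma sum_range_lower_add_upperTail (m : ℕ) (x y : ℝ) :
    ∑ k ∈ Finset.range (m / 2 + 1), (m.choose k : ℝ) * x ^ k * y ^ (m - k) + upperTail m x y =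
      (x + y) ^ m := by
  have h : Finset.Icc (m / 2 + 1) m = Finset.Ico (m / 2 + 1) (m + 1) := by
    grind
  rw [upperTail, h, Finset.sum_range_add_sum_Ico _ (by omega), add_pow]
  refine Finset.sum_congr rfl fun k _ => by ring

lemma sum_range_mul_majority (m : ℕ) (x y : ℝ) (hxy : x + y = 1) (G : Bool → ℝ) :
    ∑ k ∈ Finset.range (m + 1),
        (m.choose k : ℝ) * x ^ k * y ^ (m - k) * G (decide (m / 2 + 1 ≤ k)) =
      upperTail m x y * G true + (1 - upperTail m x y) * G false := by
  have h : Finset.Icc (m / 2 + 1) m = Finset.Ico (m / 2 + 1) (m + 1) := by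
    grind
  have hl := sum_range_lower_add_upperTail m x y
  rw [hxy, one_pow] at hl
  rw [← eq_sub_of_add_eq hl, upperTail, h,
    ← Finset.sum_range_add_sum_Ico _ (show m / 2 + 1 ≤ m + 1 by omega), add_comm,
    Finset.sum_mul, Finset.sum_mul]
  congr 1
  · refine Finset.sum_congr rfl fun k hk => ?_
    rw [Finset.mem_Ico] at hk
    rw [decide_eq_true hk.1]
  · refine Finset.sum_congr rfl fun k hk => ?_
    rw [Finset.mem_range] at hk
    rw [decide_eq_false hk.not_ge]

lemma upperTail_swap (m : ℕ) (x y : ℝ) :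
    upperTail m y x =
      ∑ k ∈ Finset.range (m - m / 2), (m.choose k : ℝ) * x ^ k * y ^ (m - k) := by
  unfold upperTail
  refine Finset.sum_bij' (fun k _ => m - k) (fun k _ => m - k) ?_ ?_ ?_ ?_ ?_ <;>
    intro k hk <;> simp only [Finset.mem_Icc, Finset.mem_range] at hk ⊢
  · omega
  · omega
  · omega
  · omega
  · rw [Nat.choose_symm hk.2, Nat.sub_sub_self hk.2]; ring

lemma gammaP_succ (α : ℝ) (m : ℕ) :
    gammaP α (m + 1) = upperTail m α (1 - α) + upperTail m (1 - α) α := by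
  have h := sum_range_lower_add_upperTail m α (1 - α)
  rw [add_sub_cancel, one_pow] at h
  rw [upperTail_swap m α (1 - α), gammaP, Nat.add_sub_cancel]
  split_ifs with hm
  · rw [Finset.sum_range_succ] at h
    have e : m - m / 2 = m / 2 := by omega
    rw [e] at h ⊢
    linarith
  · have e : m - m / 2 = m / 2 + 1 := by omega
    rw [e]
    linarith

lemma upperTail_nonneg (m : ℕ) {x y : ℝ} (hx : 0 ≤ x) (hy : 0 ≤ y) : 0 ≤ upperTail m x y :=
  Finset.sum_nonneg fun _ _ => by positivity

lemma upperTail_swap_le (m : ℕ) {x : ℝ} (hx : 0 ≤ x) (hx1 : x ≤ 1) :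
    upperTail m (1 - x) x ≤ 1 - upperTail m x (1 - x) := by
  have h := sum_range_lower_add_upperTail m x (1 - x)
  rw [add_sub_cancel, one_pow] at h
  have := sub_nonneg.mpr hx1
  rw [upperTail_swap, ← eq_sub_of_add_eq h]
  refine Finset.sum_le_sum_of_subset_of_nonneg ?_ fun _ _ _ => by positivity
  exact Finset.range_mono (by omega)

/-- Chernoff bound for a minority of successes. -/
lemma one_sub_upperTail_le (m : ℕ) {a b : ℝ} (hb : 0 ≤ b) (hab : b ≤ a)
    (h1 : a ^ 2 + b ^ 2 = 1) :
    1 - upperTail m (a ^ 2) (b ^ 2) ≤ (2 * (a * b)) ^ m := by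
  have h := sum_range_lower_add_upperTail m (a ^ 2) (b ^ 2)
  rw [h1, one_pow] at h
  have ha : 0 ≤ a := hb.trans hab
  rw [← eq_sub_of_add_eq h, mul_pow]
  calc ∑ k ∈ Finset.range (m / 2 + 1), (m.choose k : ℝ) * (a ^ 2) ^ k * (b ^ 2) ^ (m - k)
      ≤ ∑ k ∈ Finset.range (m / 2 + 1), (m.choose k : ℝ) * (a * b) ^ m := by
        refine Finset.sum_le_sum fun k hk => ?_
        rw [Finset.mem_range] at hk
        obtain ⟨l, rfl⟩ : ∃ l, m = 2 * k + l := ⟨m - 2 * k, by omega⟩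
        rw [mul_assoc]
        gcongr
        have e : 2 * k + l - k = k + l := by omega
        rw [e]
        calc (a ^ 2) ^ k * (b ^ 2) ^ (k + l) = (a * b) ^ (2 * k) * (b * b) ^ l := by ring
          _ ≤ (a * b) ^ (2 * k) * (a * b) ^ l := by gcongr
          _ = (a * b) ^ (2 * k + l) := by ring
    _ ≤ ∑ k ∈ Finset.range (m + 1), (m.choose k : ℝ) * (a * b) ^ m := by
        refine Finset.sum_le_sum_of_subset_of_nonneg (Finset.range_mono (by omega))
          fun _ _ _ => by positivity
    _ = 2 ^ m * (a * b) ^ m := by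
        rw [← Finset.sum_mul]
        congr 1
        exact_mod_cast Nat.sum_range_choose m

/-- The expected payment in terms of the conditional probabilities `B`, `c` that the others'
majority is `1` given the state `1`, resp. `0`, without the factor depending on `g'`. -/
noncomputable def payForm (p θ α B c : ℝ) : ℝ :=
  ((p * α * B + (1 - p) * (1 - α) * c) * (p * (1 - B) + (1 - p) * (1 - c)) +
      (p * (1 - α) * (1 - B) + (1 - p) * α * (1 - c)) * (p * B + (1 - p) * c)) /
    ((B - c) * (2 * θ - 1) * p * (1 - p))

lemma expPay_mechR (p θ ε : ℝ) (g' : ℝ → ℝ) {m : ℕ} (hm : 1 ≤ m) (i : Fin (m + 1)) :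
    expPay p θ (fun _ => epsStrategy ε) (mechR p θ g' ε) i =
      (g' ε * (Real.exp ε + 1) ^ 2 / (2 * Real.exp ε)) *
        payForm p θ (alphaP θ ε) (upperTail m (alphaP θ ε) (1 - alphaP θ ε))
          (upperTail m (1 - alphaP θ ε) (alphaP θ ε)) := by
  rw [expPay_epsStrategy]
  set α := alphaP θ ε
  set K := g' ε * (Real.exp ε + 1) ^ 2 / (2 * Real.exp ε)
  let A : Bool → Bool → ℝ := fun b M => match b, M with
    | true, true => A11 p θ α (m + 1)
    | false, false => A00 p θ α (m + 1)
    | _, _ => 0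
  have hsum (w : Bool) : ∑ x : Fin (m + 1) → Bool, (∏ j, reportProb α w (some (x j))) *
      mechR p θ g' ε (fun j => some (x j)) i =
        ∑ b, reportProb α w (some b) * (K *
          (upperTail m (reportProb α w (some true)) (reportProb α w (some false)) * A b true +
          (1 - upperTail m (reportProb α w (some true)) (reportProb α w (some false))) *
            A b false)) := by
    rw [← (Fin.insertNthEquiv (fun _ => Bool) i).sum_comp, Fintype.sum_prod_type]
    refine Finset.sum_congr rfl fun b _ => ?_
    have hR (y : Fin m → Bool) : mechR p θ g' ε
        (fun j => some (i.insertNth (α := fun _ => Bool) b y j)) i = K * A b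
          (decide (m / 2 + 1 ≤ (Finset.univ.filter fun j => y j = true).card)) := by
      rw [mechR, majOthers_insertNth, participants_some, if_neg (by simp; omega)]
      simp only [Fin.insertNth_apply_same, Finset.card_univ, Fintype.card_fin]
      congr 1
      cases b <;> cases decide (m / 2 + 1 ≤ (Finset.univ.filter fun j => y j = true).card) <;>
        rfl
    have hxy : reportProb α w (some true) + reportProb α w (some false) = 1 := by
      cases w <;> simp [reportProb]
    rw [← sum_range_mul_majority m _ _ hxy (A b)]
    have := sum_pi_bool_mul_card (m := m) (fun b => reportProb α w (some b))
      (fun k => A b (decide (m / 2 + 1 ≤ k)))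
    rw [← this, Finset.mul_sum, Finset.mul_sum]
    refine Finset.sum_congr rfl fun y _ => ?_
    simp only [Fin.insertNthEquiv_apply]
    rw [hR, Fin.prod_univ_succAbove _ i]
    simp only [Fin.insertNth_apply_same, Fin.insertNth_apply_succAbove]
    ring
  simp only [hsum]
  simp only [Fintype.sum_bool, reportProb, A, A11, A00, betaP_succ, gammaP_succ, payForm,
    reduceIte, Bool.false_eq_true, Bool.true_eq_false]
  set B := upperTail m α (1 - α)
  set c := upperTail m (1 - α) α
  have e : 2 * B - (B + c) = B - c := by ring
  rw [e]
  ring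

lemma abs_payForm_sub_le {p θ α B c : ℝ} (hp0 : 0 < p) (hp1 : p < 1) (hθ : 1 / 2 < θ)
    (hα0 : 0 ≤ α) (hα1 : α ≤ 1) (hc : 0 ≤ c) (hcB : c ≤ 1 - B) (hB : 3 / 4 ≤ B) :
    |payForm p θ α B c - 2 * α / (2 * θ - 1)| ≤ 12 / ((2 * θ - 1) * p * (1 - p)) * (1 - B) := by
  have hT : 0 < 2 * θ - 1 := by linarith
  have hq0 : 0 < 1 - p := by linarith
  have hα' : 0 ≤ 1 - α := by linarith
  have hBc : 1 / 2 ≤ B - c := by linarith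
  have hBc0 : 0 < B - c := by linarith
  have hδ : 0 ≤ 1 - B := by linarith
  have hc1 : 0 ≤ 1 - c := by linarith
  have hB0 : 0 ≤ B := by linarith
  set q := 1 - p with hq
  set dev := 2 * p * q * α * (1 - B) * c + p ^ 2 * α * B * (1 - B) +
    q ^ 2 * α * (1 - c) * c + p * (1 - α) * (p * B + q * c) * (1 - B) +
    q * (1 - α) * (p * (1 - B) + q * (1 - c)) * c with hdev
  have hEq : payForm p θ α B c - 2 * α / (2 * θ - 1) =
      dev / ((B - c) * ((2 * θ - 1) * p * q)) := by
    rw [payForm, ← hq, hdev]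
    field_simp
    ring
  have hdev0 : 0 ≤ dev := by positivity
  have hdev1 : dev ≤ 6 * (1 - B) := by
    have hp1' : p ≤ 1 := hp1.le
    have hq1 : q ≤ 1 := by linarith
    have hB1 : B ≤ 1 := by linarith
    have hc1' : c ≤ 1 := by linarith
    have hδ1 : 1 - B ≤ 1 := by linarith
    have hY : p * B + q * c ≤ 1 := by nlinarith
    have hZ : p * (1 - B) + q * (1 - c) ≤ 1 := by nlinarith
    have h1 : 2 * p * q * α * (1 - B) * c ≤ 2 * 1 * 1 * 1 * (1 - B) * 1 := by gcongr
    have h2 : p ^ 2 * α * B * (1 - B) ≤ 1 ^ 2 * 1 * 1 * (1 - B) := by gcongr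
    have h3 : q ^ 2 * α * (1 - c) * c ≤ 1 ^ 2 * 1 * 1 * (1 - B) := by
      gcongr; linarith
    have h4 : p * (1 - α) * (p * B + q * c) * (1 - B) ≤ 1 * 1 * 1 * (1 - B) := by
      gcongr; linarith
    have h5 : q * (1 - α) * (p * (1 - B) + q * (1 - c)) * c ≤ 1 * 1 * 1 * (1 - B) := by
      gcongr; linarith
    linarith
  rw [hEq, abs_of_nonneg (by positivity)]
  calc dev / ((B - c) * ((2 * θ - 1) * p * q))
      ≤ 6 * (1 - B) / (1 / 2 * ((2 * θ - 1) * p * q)) := by gcongr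
    _ = 12 / ((2 * θ - 1) * p * q) * (1 - B) := by field_simp; ring

lemma payForm_sub_isBigO {p θ a b : ℝ} (hp0 : 0 < p) (hp1 : p < 1) (hθ : 1 / 2 < θ)
    (hb : 0 ≤ b) (hab : b < a) (h1 : a ^ 2 + b ^ 2 = 1) :
    (fun m : ℕ => payForm p θ (a ^ 2) (upperTail m (a ^ 2) (b ^ 2))
        (upperTail m (b ^ 2) (a ^ 2)) - 2 * a ^ 2 / (2 * θ - 1)) =O[Filter.atTop]
      fun m => (2 * (a * b)) ^ m := by
  have ha : 0 ≤ a := hb.trans hab.le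
  have hρ1 : 2 * (a * b) < 1 := by nlinarith [mul_pos (sub_pos.2 hab) (sub_pos.2 hab)]
  have hT : 0 < 2 * θ - 1 := by linarith
  have hq0 : 0 < 1 - p := by linarith
  have hlim := tendsto_pow_atTop_nhds_zero_of_lt_one (r := 2 * (a * b)) (by positivity) hρ1
  refine Asymptotics.IsBigO.of_bound (12 / ((2 * θ - 1) * p * (1 - p))) ?_
  filter_upwards [hlim.eventually_le_const (show (0 : ℝ) < 1 / 4 by norm_num)] with m hm
  have hB := one_sub_upperTail_le m hb hab.le h1
  have hb2 : b ^ 2 = 1 - a ^ 2 := by linarith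
  have ha1 : a ^ 2 ≤ 1 := by nlinarith
  have hc := upperTail_swap_le m (sq_nonneg a) ha1
  rw [← hb2] at hc
  rw [Real.norm_eq_abs, Real.norm_of_nonneg (by positivity)]
  refine (abs_payForm_sub_le hp0 hp1 hθ (sq_nonneg a) ha1
    (upperTail_nonneg m (sq_nonneg b) (sq_nonneg a)) hc (by linarith)).trans ?_
  gcongr

lemma VLB_eq {θ ε : ℝ} (hθ : 1 / 2 < θ) (g' : ℝ → ℝ) :
    VLB θ g' ε = (g' ε * (Real.exp ε + 1) ^ 2 / (2 * Real.exp ε)) *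
      (2 * alphaP θ ε / (2 * θ - 1)) := by
  have hT : 2 * θ - 1 ≠ 0 := by linarith
  have : Real.exp ε + 1 ≠ 0 := by positivity
  rw [VLB, alphaP, div_mul_eq_mul_div, div_sub_one hT]
  field_simp
  ring

lemma alphaP_lt_one {θ : ℝ} (hθ0 : 0 < θ) (hθ1 : θ < 1) (ε : ℝ) : alphaP θ ε < 1 := by
  have := Real.exp_pos ε
  rw [alphaP, div_lt_one (by positivity)]
  nlinarith [mul_pos (sub_pos.2 hθ1) this]

lemma half_lt_alphaP {θ ε : ℝ} (hθ : 1 / 2 < θ) (hε : 0 < ε) : 1 / 2 < alphaP θ ε := by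
  have := Real.one_lt_exp_iff.2 hε
  rw [alphaP, lt_div_iff₀ (by positivity)]
  nlinarith

lemma exp_neg_dExp {θ ε : ℝ} (h0 : 0 < alphaP θ ε) (h1 : alphaP θ ε < 1) :
    Real.exp (-dExp θ ε) = 2 * (√(alphaP θ ε) * √(1 - alphaP θ ε)) := by
  have h1' := sub_pos.2 h1
  have hpos : 0 < 2 * (√(alphaP θ ε) * √(1 - alphaP θ ε)) := by positivity
  have hsq : (Real.exp ε + 1) ^ 2 /
      (4 * (θ * Real.exp ε + 1 - θ) * ((1 - θ) * Real.exp ε + θ)) =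
        ((2 * (√(alphaP θ ε) * √(1 - alphaP θ ε))) ^ 2)⁻¹ := by
    rw [mul_pow, mul_pow, Real.sq_sqrt h0.le, Real.sq_sqrt h1'.le, alphaP]
    have : Real.exp ε + 1 ≠ 0 := by positivity
    rw [inv_eq_one_div, one_sub_div this, div_mul_div_comm, mul_div_assoc', one_div_div]
    congr 1 <;> ring
  rw [dExp, hsq, Real.log_inv, Real.log_pow]
  rw [← Real.exp_log hpos]
  simp only [Real.log_exp]
  congr 1
  push_cast
  ring

/-- **Payment bound for the designed mechanism:** for every `ε > 0` there is `C > 0`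
such that for all `N ≥ 2`, the expected payment to each individual at the equilibrium
`σ^{(ε)}` of `R^{(N,ε)}` is at most `V_LB(ε) + C·e^{−N·d}`. -/
theorem designed_mechanism_payment_bound
    (p θ : ℝ) (hp0 : 0 < p) (hp1 : p < 1)
    (hθ : 1/2 < θ) (hθ1 : θ < 1)
    (g g' : ℝ → ℝ) (hg : ProperCost g g')
    (ε : ℝ) (hε : 0 < ε) :
    ∃ C : ℝ, 0 < C ∧
      ∀ N : ℕ, 2 ≤ N → ∀ i : Fin N,
        expPay p θ (fun _ : Fin N => epsStrategy ε) (mechR p θ g' ε) i ≤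
          VLB θ g' ε + C * Real.exp (-(N : ℝ) * dExp θ ε) := by
  have hα := half_lt_alphaP hθ hε
  have hα1 := alphaP_lt_one (by linarith) hθ1 ε
  have hexp := exp_neg_dExp (by linarith) hα1
  set K := g' ε * (Real.exp ε + 1) ^ 2 / (2 * Real.exp ε) with hK
  have hα0 : 0 < alphaP θ ε := by linarith
  have ha := Real.sq_sqrt hα0.le
  have hb := Real.sq_sqrt (sub_pos.2 hα1).le
  have hO := payForm_sub_isBigO hp0 hp1 hθ (Real.sqrt_nonneg (1 - alphaP θ ε))
    (Real.sqrt_lt_sqrt (sub_pos.2 hα1).le (by linarith : 1 - alphaP θ ε < alphaP θ ε))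
    (by rw [ha, hb]; ring)
  rw [ha, hb, ← hexp] at hO
  obtain ⟨C, hC, hbound⟩ := Asymptotics.bound_of_isBigO_nat_atTop hO
  refine ⟨(|K| + 1) * C * Real.exp (dExp θ ε), by positivity, fun N hN i => ?_⟩
  obtain ⟨m, rfl⟩ : ∃ m, N = m + 1 := ⟨N - 1, by omega⟩
  rw [expPay_mechR p θ ε g' (by omega) i, VLB_eq hθ, ← hK, ← sub_le_iff_le_add', ← mul_sub]
  have hm := hbound (x := m) (by positivity)
  rw [Real.norm_eq_abs, Real.norm_of_nonneg (by positivity)] at hm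
  refine (le_abs_self _).trans ?_
  rw [abs_mul]
  calc _ ≤ (|K| + 1) * (C * Real.exp (-dExp θ ε) ^ m) := by gcongr; linarith
    _ = (|K| + 1) * C * Real.exp (dExp θ ε) * Real.exp (-((m + 1 : ℕ) : ℝ) * dExp θ ε) := by
      rw [mul_assoc _ (Real.exp _), ← Real.exp_add, ← Real.exp_nat_mul, mul_assoc]
      congr 3
      push_cast
      ring
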